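/- Let d ≥ 3 and n ≥ 1 be integers, Δ > 0, T = nΔ, h_1, …, h_d ∈ (0, 1) with h_1 h_2 ≤ (∏_{l=3}^d h_l)^{2/(d−2)}, and A > 0, ρ > 0. Write H = ∏_{l=1}^d h_l and H_3 = ∏_{l=3}^d h_l. Let k : {0, …, n−1} → ℝ satisfy: (i) |k(j)| ≤ A/H for all j; (ii) |k(j)| ≤ (A/H_3)·1/(jΔ) for all j ≥ 1; (iii) |k(j)| ≤ A((jΔ)^{−d/2} + 1) for all j ≥ 1; (iv) |k(j)| ≤ (A/H²)·e^{−ρ j Δ} for all j. Then there exist constants C > 0 and T_0 > 0, depending only on A, ρ and d, such that for all T ≥ T_0: (Δ²/T²)·∑_{j=0}^{n−1} (n − j)|k(j)| ≤ (C/T)·((1 + ∑_{l=1}^d |log h_l|)/H_3 + Δ/H). -/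

import Mathlib

open Finset

lemma core_sum_bound (A ρ : ℝ) (hA : 0 < A) (hρ : 0 < ρ) (n : ℕ) (Δ : ℝ) (hΔ : 0 < Δ)
    (a b S : ℝ) (ha : 0 < a) (ha1 : a < 1) (hb : 0 < b) (hb1 : b ≤ 1)
    (hS : S = -Real.log (a * b)) (k : ℕ → ℝ)
    (h1 : ∀ j, j < n → |k j| ≤ A / (a * b))
    (h2 : ∀ j, 1 ≤ j → j < n → |k j| ≤ (A / b) * (1 / ((j : ℝ) * Δ)))
    (h4 : ∀ j, j < n → |k j| ≤ (A / (a * b) ^ 2) * Real.exp (-ρ * (j : ℝ) * Δ)) :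
    Δ * ∑ j ∈ range n, |k j| ≤ (4 * A + 5 * A / ρ) * ((1 + S) / b + Δ / (a * b)) := by
  have hab : 0 < a * b := mul_pos ha hb
  have hab1 : a * b ≤ 1 := by nlinarith
  have hS0 : 0 ≤ S := by
    rw [hS]; linarith [Real.log_nonpos hab.le hab1]
  obtain ⟨M, hM⟩ : ∃ M, M = 2 / ρ * S := ⟨_, rfl⟩
  have hM0 : 0 ≤ M := by rw [hM]; positivity
  obtain ⟨N, hN⟩ : ∃ N, N = ⌊M / Δ⌋₊ := ⟨_, rfl⟩
  have hN1 : (N : ℝ) * Δ ≤ M := by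
    have := Nat.floor_le (div_nonneg hM0 hΔ.le)
    rw [← hN] at this
    exact (le_div_iff₀ hΔ).1 this
  have hN2 : M < ((N : ℝ) + 1) * Δ := by
    have := Nat.lt_floor_add_one (M / Δ)
    rw [← hN] at this
    exact (div_lt_iff₀ hΔ).1 this
  let f : ℕ → ℝ := fun j => if j < n then |k j| else 0
  have hf0 : ∀ j, 0 ≤ f j := fun j => by
    simp only [f]; split_ifs <;> simp
  have e1 : ∑ j ∈ range n, |k j| = ∑ j ∈ range n, f j :=
    sum_congr rfl fun j hj => by simp [f, mem_range.1 hj]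
  have e2 : ∑ j ∈ range n, f j ≤ ∑ j ∈ range (N + 1 + n), f j :=
    sum_le_sum_of_subset_of_nonneg (range_mono (by omega)) fun j _ _ => hf0 j
  have e3 : ∑ j ∈ range (N + 1 + n), f j
      = (∑ i ∈ range N, f (i + 1)) + f 0 + ∑ i ∈ range n, f (N + 1 + i) := by
    rw [sum_range_add, sum_range_succ']
  have b0 : Δ * f 0 ≤ A * (Δ / (a * b)) := by
    have : f 0 ≤ A / (a * b) := by
      simp only [f]; split_ifs with hh
      · exact h1 0 hh
      · positivity
    calc Δ * f 0 ≤ Δ * (A / (a * b)) := by gcongr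
      _ = _ := by ring
  have b1 : ∀ i, Δ * f (i + 1) ≤ 2 * A / b *
      (Real.log (((i + 1 : ℕ) : ℝ) * Δ + a) - Real.log ((i : ℝ) * Δ + a)) := by
    intro i
    have hi : (0 : ℝ) ≤ i := Nat.cast_nonneg i
    have p0 : 0 < (i : ℝ) * Δ + a := by positivity
    have p1 : 0 < ((i : ℝ) + 1) * Δ + a := by positivity
    have pt : 0 < ((i : ℝ) + 1) * Δ := by positivity
    push_cast
    have l1 : Δ / (((i : ℝ) + 1) * Δ + a) ≤
        Real.log (((i : ℝ) + 1) * Δ + a) - Real.log ((i : ℝ) * Δ + a) := by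
      have := Real.log_le_sub_one_of_pos (div_pos p0 p1)
      rw [Real.log_div p0.ne' p1.ne'] at this
      have e : Δ / (((i : ℝ) + 1) * Δ + a)
          = 1 - ((i : ℝ) * Δ + a) / (((i : ℝ) + 1) * Δ + a) := by
        field_simp; ring
      linarith
    have l2 : f (i + 1) ≤ 2 * A / b * (1 / (((i : ℝ) + 1) * Δ + a)) := by
      simp only [f]; split_ifs with hh
      · rcases le_total (((i : ℝ) + 1) * Δ) a with hc | hc
        · refine (h1 _ hh).trans ?_
          rw [show A / (a * b) = 2 * A / b * (1 / (2 * a)) by field_simp]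
          gcongr
          linarith
        · refine (h2 _ (by omega) hh).trans ?_
          push_cast
          rw [show A / b * (1 / (((i : ℝ) + 1) * Δ))
            = 2 * A / b * (1 / (2 * (((i : ℝ) + 1) * Δ))) by field_simp]
          gcongr
          linarith
      · positivity
    calc Δ * f (i + 1) ≤ Δ * (2 * A / b * (1 / (((i : ℝ) + 1) * Δ + a))) := by gcongr
      _ = 2 * A / b * (Δ / (((i : ℝ) + 1) * Δ + a)) := by ring
      _ ≤ _ := by gcongr
  have b2 : Δ * ∑ i ∈ range N, f (i + 1) ≤ 2 * A / b * (M + S) := by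
    rw [mul_sum]
    refine (sum_le_sum fun i _ => b1 i).trans ?_
    rw [← mul_sum, sum_range_sub (fun i : ℕ => Real.log ((i : ℝ) * Δ + a))]
    gcongr
    have q1 : Real.log ((N : ℝ) * Δ + a) ≤ M := by
      have := Real.log_le_sub_one_of_pos (show 0 < (N : ℝ) * Δ + a by positivity)
      linarith
    have q2 : -Real.log a ≤ S := by
      rw [hS, Real.log_mul ha.ne' hb.ne']
      linarith [Real.log_nonpos hb.le hb1]
    simp only [Nat.cast_zero, zero_mul, zero_add]
    linarith
  have hr : ∀ i : ℕ, f (N + 1 + i) ≤ A * Real.exp (-(ρ * Δ)) ^ i := by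
    intro i
    simp only [f]; split_ifs with hh
    · refine (h4 _ hh).trans ?_
      have e : (1 : ℝ) / (a * b) ^ 2 = Real.exp (ρ * M) := by
        rw [hM, hS, show ρ * (2 / ρ * -Real.log (a * b)) = -(Real.log (a * b) + Real.log (a * b)) by
          field_simp; ring, Real.exp_neg, Real.exp_add, Real.exp_log hab]
        simp [sq]
      rw [← Real.exp_nat_mul, div_eq_mul_one_div, e, mul_assoc, ← Real.exp_add]
      gcongr
      push_cast
      nlinarith
    · positivity
  have b3 : Δ * ∑ i ∈ range n, f (N + 1 + i) ≤ A * (Δ + 1 / ρ) := by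
    have x0 : 0 < ρ * Δ := mul_pos hρ hΔ
    have r1 : Real.exp (-(ρ * Δ)) < 1 := by rw [← Real.exp_zero]; exact Real.exp_lt_exp.2 (by linarith)
    have g : ∑ i ∈ range n, Real.exp (-(ρ * Δ)) ^ i ≤ (1 - Real.exp (-(ρ * Δ)))⁻¹ := by
      rw [← tsum_geometric_of_lt_one (Real.exp_pos _).le r1]
      exact (summable_geometric_of_lt_one (Real.exp_pos _).le r1).sum_le_tsum _
        fun i _ => by positivity
    have g2 : (1 - Real.exp (-(ρ * Δ)))⁻¹ ≤ (1 + ρ * Δ) / (ρ * Δ) := by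
      have : Real.exp (-(ρ * Δ)) ≤ 1 / (1 + ρ * Δ) := by
        rw [Real.exp_neg, one_div]
        gcongr
        linarith [Real.add_one_le_exp (ρ * Δ)]
      rw [← inv_div]
      gcongr
      have e : ρ * Δ / (1 + ρ * Δ) = 1 - 1 / (1 + ρ * Δ) := by field_simp; ring
      linarith
    calc Δ * ∑ i ∈ range n, f (N + 1 + i)
        ≤ Δ * ∑ i ∈ range n, A * Real.exp (-(ρ * Δ)) ^ i := by
          gcongr with i _; exact hr i
      _ ≤ Δ * (A * ((1 + ρ * Δ) / (ρ * Δ))) := by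
          rw [← mul_sum]; gcongr; exact g.trans g2
      _ = A * (Δ + 1 / ρ) := by field_simp; ring
  have c1 : Δ ≤ Δ / (a * b) := by
    rw [le_div_iff₀ hab]; nlinarith
  have c2 : 1 ≤ (1 + S) / b := by
    rw [le_div_iff₀ hb]; linarith
  have c3 : 2 * A / b * (M + S) ≤ (2 * A + 4 * A / ρ) * ((1 + S) / b) := by
    rw [hM, show 2 * A / b * (2 / ρ * S + S) = (2 * A + 4 * A / ρ) * (S / b) by field_simp; ring]
    gcongr
    linarith
  have c4 : A * (Δ + 1 / ρ) ≤ A * (Δ / (a * b)) + A / ρ * ((1 + S) / b) := by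
    have : A / ρ * 1 ≤ A / ρ * ((1 + S) / b) := by gcongr
    have : A * Δ ≤ A * (Δ / (a * b)) := by gcongr
    have : A * (1 / ρ) = A / ρ := by ring
    linarith
  have d1 : 0 ≤ A * ((1 + S) / b) := by positivity
  have d2 : 0 ≤ A * (Δ / (a * b)) := by positivity
  have d3 : 0 ≤ A / ρ * (Δ / (a * b)) := by positivity
  have t1 : Δ * ∑ j ∈ range n, |k j| ≤ Δ * ((∑ i ∈ range N, f (i + 1)) + f 0 +
      ∑ i ∈ range n, f (N + 1 + i)) := by
    rw [e1, ← e3]; gcongr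
  have t2 : (4 * A + 5 * A / ρ) * ((1 + S) / b + Δ / (a * b))
    = 4 * (A * ((1 + S) / b)) + 5 * (A / ρ * ((1 + S) / b)) + 4 * (A * (Δ / (a * b)))
      + 5 * (A / ρ * (Δ / (a * b))) := by ring
  have t3 : (2 * A + 4 * A / ρ) * ((1 + S) / b)
    = 2 * (A * ((1 + S) / b)) + 4 * (A / ρ * ((1 + S) / b)) := by ring
  rw [t2]
  linarith

/-- Deterministic summation core of the variance bound (`d ≥ 3`, cases `k₀ = 1` with
`β₂ < β₃`, or `k₀ = 2`): if `k(j)` satisfies the four covariance bounds (i)–(iv), then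
`(Δ²/T²)·∑_{j<n} (n − j)|k(j)| ≤ (C/T)·((1 + ∑ |log h_l|)/H₃ + Δ/H)` with `T = nΔ`,
for constants `C, T₀` depending only on `A, ρ, d`. -/
theorem discrete_variance_sum_bound_k0_small (d : ℕ) (hd : 3 ≤ d)
    (A ρ : ℝ) (hA : 0 < A) (hρ : 0 < ρ) :
    ∃ C > (0:ℝ), ∃ T0 > (0:ℝ),
      ∀ (n : ℕ), 1 ≤ n → ∀ (Δ : ℝ), 0 < Δ →
      ∀ (h : Fin d → ℝ), (∀ l, h l ∈ Set.Ioo (0:ℝ) 1) →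
      h ⟨0, by omega⟩ * h ⟨1, by omega⟩
        ≤ (∏ l ∈ Finset.univ.filter (fun l : Fin d => 2 ≤ l.val), h l)
            ^ ((2:ℝ) / ((d:ℝ) - 2)) →
      ∀ (k : ℕ → ℝ),
        (∀ j, j < n → |k j| ≤ A / ∏ l, h l) →
        (∀ j, 1 ≤ j → j < n →
          |k j| ≤ (A / ∏ l ∈ Finset.univ.filter (fun l : Fin d => 2 ≤ l.val), h l)
                    * (1 / ((j : ℝ) * Δ))) →
        (∀ j, 1 ≤ j → j < n → |k j| ≤ A * (((j : ℝ) * Δ) ^ (-(d:ℝ)/2) + 1)) →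
        (∀ j, j < n → |k j| ≤ (A / (∏ l, h l) ^ 2) * Real.exp (-ρ * (j : ℝ) * Δ)) →
        T0 ≤ (n : ℝ) * Δ →
        Δ ^ 2 / ((n : ℝ) * Δ) ^ 2 * ∑ j ∈ Finset.range n, ((n : ℝ) - (j : ℝ)) * |k j|
          ≤ C / ((n : ℝ) * Δ)
              * ((1 + ∑ l, |Real.log (h l)|)
                    / ∏ l ∈ Finset.univ.filter (fun l : Fin d => 2 ≤ l.val), h l
                  + Δ / ∏ l, h l) := by
  refine ⟨4 * A + 5 * A / ρ, by positivity, 1, one_pos, ?_⟩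
  intro n hn Δ hΔ h hh _ k h1 h2 _ h4 _
  obtain ⟨b, hb⟩ : ∃ b, b = ∏ l ∈ Finset.univ.filter (fun l : Fin d => 2 ≤ l.val), h l := ⟨_, rfl⟩
  obtain ⟨a, ha⟩ : ∃ a, a = h ⟨0, by omega⟩ * h ⟨1, by omega⟩ := ⟨_, rfl⟩
  have hH : ∏ l, h l = a * b := by
    rw [← Finset.prod_filter_mul_prod_filter_not Finset.univ (fun l : Fin d => 2 ≤ l.val), ← hb,
      mul_comm, ha]
    congr 1
    have : Finset.univ.filter (fun l : Fin d => ¬ 2 ≤ l.val)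
        = {⟨0, by omega⟩, ⟨1, by omega⟩} := by
      ext l
      simp only [Finset.mem_filter, Finset.mem_univ, true_and, Finset.mem_insert,
        Finset.mem_singleton, Fin.ext_iff]
      omega
    rw [this, Finset.prod_pair (by simp [Fin.ext_iff])]
  have hS : ∑ l, |Real.log (h l)| = -Real.log (a * b) := by
    rw [← hH, Real.log_prod (fun l _ => (hh l).1.ne'), ← Finset.sum_neg_distrib]
    exact Finset.sum_congr rfl fun l _ =>
      abs_of_nonpos (Real.log_nonpos (hh l).1.le (hh l).2.le)
  have hb0 : 0 < b := hb ▸ Finset.prod_pos fun l _ => (hh l).1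
  have hb1 : b ≤ 1 := hb ▸ Finset.prod_le_one (fun l _ => (hh l).1.le) fun l _ => (hh l).2.le
  have ha0 : 0 < a := ha ▸ mul_pos (hh _).1 (hh _).1
  have ha1 : a < 1 := ha ▸ mul_lt_one_of_nonneg_of_lt_one_left (hh _).1.le (hh _).2 (hh _).2.le
  rw [← hb] at h2
  rw [hH] at h1 h4
  rw [← hb, hH]
  have key := core_sum_bound A ρ hA hρ n Δ hΔ a b _ ha0 ha1 hb0 hb1 hS k h1 h2 h4
  have hn0 : (0 : ℝ) < n := by exact_mod_cast hn
  have s1 : ∑ j ∈ Finset.range n, ((n : ℝ) - (j : ℝ)) * |k j|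
      ≤ n * ∑ j ∈ Finset.range n, |k j| := by
    rw [Finset.mul_sum]
    refine Finset.sum_le_sum fun j _ => ?_
    gcongr
    linarith [(Nat.cast_nonneg j : (0 : ℝ) ≤ j)]
  calc _ ≤ Δ ^ 2 / ((n : ℝ) * Δ) ^ 2 * (n * ∑ j ∈ Finset.range n, |k j|) := by gcongr
    _ = 1 / ((n : ℝ) * Δ) * (Δ * ∑ j ∈ Finset.range n, |k j|) := by field_simp
    _ ≤ 1 / ((n : ℝ) * Δ) * ((4 * A + 5 * A / ρ) *
        ((1 + ∑ l, |Real.log (h l)|) / b + Δ / (a * b))) := by gcongr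
    _ = _ := by ring
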